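/- arXiv:2506.22427 — 4 statements merged into one kernel-verified Lean document; each statement's English description precedes it below -/
import Mathlib

section
/- Let δ > 0 and let L_i, L_j ∈ R^K be the loss vectors of two clients. Suppose there are indices k₁ ≠ k₂ such that the k₁-th entry of L_i is its smallest entry with gap at least δ (i.e. L_i(k) ≥ L_i(k₁) + δ for every k ≠ k₁), and the k₂-th entry of L_j is its smallest entry with gap at least δ (i.e. L_j(k) ≥ L_j(k₂) + δ for every k ≠ k₂). Then ‖L_i − L_j‖ ≥ √2 · δ in the Euclidean norm. -/
theorem EuclideanSpace.sq_add_sq_le_norm_sq {ι : Type*} [Fintype ι] (x : EuclideanSpace ℝ ι)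
    {i j : ι} (hij : i ≠ j) : x i ^ 2 + x j ^ 2 ≤ ‖x‖ ^ 2 := by
  classical
  rw [EuclideanSpace.real_norm_sq_eq, ← Finset.sum_pair (f := fun k => x k ^ 2) hij]
  exact Finset.sum_le_sum_of_subset_of_nonneg (Finset.subset_univ _) fun _ _ _ => sq_nonneg _

/-- If client `i`'s loss vector `Li` achieves its minimum at index `k₁` with a gap of at
least `δ` to every other entry, client `j`'s loss vector `Lj` achieves its minimum at a
different index `k₂` with the same gap `δ`, then the Euclidean distance between the two
loss vectors is at least `√2 · δ`. -/
theorem loss_vector_separation {K : ℕ} (δ : ℝ) (hδ : 0 < δ)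
    (Li Lj : EuclideanSpace ℝ (Fin K)) (k₁ k₂ : Fin K) (hk : k₁ ≠ k₂)
    (hLi : ∀ k : Fin K, k ≠ k₁ → Li k₁ + δ ≤ Li k)
    (hLj : ∀ k : Fin K, k ≠ k₂ → Lj k₂ + δ ≤ Lj k) :
    Real.sqrt 2 * δ ≤ ‖Li - Lj‖ := by
  have hi := hLi k₂ hk.symm
  have hj := hLj k₁ hk
  have hnorm := EuclideanSpace.sq_add_sq_le_norm_sq (Li - Lj) hk
  simp only [PiLp.sub_apply] at hnorm
  refine (sq_le_sq₀ (by positivity) (norm_nonneg _)).mp ?_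
  rw [mul_pow, Real.sq_sqrt zero_le_two]
  nlinarith [sq_nonneg ((Li k₁ - Lj k₁) + (Li k₂ - Lj k₂))]
end

section
/- Suppose N = d and θ_1, …, θ_d is an orthonormal basis of R^d. Then for all i ≠ j in [K], the SLV-means satisfy ‖c_i − c_j‖ ≥ ‖θ*_i − θ*_j‖ / √(4 + σ²) ≥ Δ / √(4 + σ²). -/
/-- For unit vectors `u, x, y`, the difference of the coordinates of `x` and `y` along `u` is
controlled by the difference of their smoothed distances to `u`. -/
lemma abs_inner_sub_le_sqrt_mul_abs_sqrt_sub {E : Type*} [NormedAddCommGroup E]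
    [InnerProductSpace ℝ E] {u x y : E} (hu : ‖u‖ = 1) (hx : ‖x‖ = 1) (hy : ‖y‖ = 1) (σ : ℝ) :
    |inner ℝ u (x - y)| ≤ √(4 + σ ^ 2) * |√(‖u - x‖ ^ 2 + σ ^ 2) - √(‖u - y‖ ^ 2 + σ ^ 2)| := by
  have dist_le {z : E} (hz : ‖z‖ = 1) : √(‖u - z‖ ^ 2 + σ ^ 2) ≤ √(4 + σ ^ 2) := by
    have h := norm_sub_le u z
    rw [hu, hz] at h
    exact Real.sqrt_le_sqrt (by nlinarith [norm_nonneg (u - z)])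
  have key : inner ℝ u (x - y) =
      (√(‖u - x‖ ^ 2 + σ ^ 2) + √(‖u - y‖ ^ 2 + σ ^ 2)) / 2 *
        -(√(‖u - x‖ ^ 2 + σ ^ 2) - √(‖u - y‖ ^ 2 + σ ^ 2)) := by
    have hsx := Real.sq_sqrt (show 0 ≤ ‖u - x‖ ^ 2 + σ ^ 2 by positivity)
    have hsy := Real.sq_sqrt (show 0 ≤ ‖u - y‖ ^ 2 + σ ^ 2 by positivity)
    have hnx := norm_sub_sq_real u x
    have hny := norm_sub_sq_real u y
    rw [hu, hx] at hnx
    rw [hu, hy] at hny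
    rw [inner_sub_right]
    linarith
  rw [key, abs_mul, abs_neg, abs_of_nonneg (by positivity)]
  gcongr
  linarith [dist_le hx, dist_le hy]


/-- For an orthonormal basis `θ₁, …, θ_d` of `ℝ^d` (here `N = d`), the SLV-means
`c k = (√(‖θ j - θ*_k‖² + σ²))_j` of distinct clusters `i ≠ j` satisfy
`‖c i - c j‖ ≥ ‖θ*_i - θ*_j‖ / √(4 + σ²) ≥ Δ / √(4 + σ²)`. -/
theorem slv_mean_separation_orthonormal {d K : ℕ} (hK : 2 ≤ K)
    (θstar : Fin K → EuclideanSpace ℝ (Fin d))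
    (hunit : ∀ k, ‖θstar k‖ = 1)
    (Δ : ℝ) (hΔ : 0 < Δ)
    (hsep : ∀ i j : Fin K, i ≠ j → Δ ≤ ‖θstar i - θstar j‖)
    (σ : ℝ) (hσ : 0 ≤ σ)
    (θ : Fin d → EuclideanSpace ℝ (Fin d))
    (b : OrthonormalBasis (Fin d) ℝ (EuclideanSpace ℝ (Fin d)))
    (hθ : ∀ j, θ j = b j)
    (c : Fin K → EuclideanSpace ℝ (Fin d))
    (hc : ∀ k (j : Fin d), c k j = Real.sqrt (‖θ j - θstar k‖ ^ 2 + σ ^ 2)) :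
    ∀ i j : Fin K, i ≠ j →
      ‖θstar i - θstar j‖ / Real.sqrt (4 + σ ^ 2) ≤ ‖c i - c j‖ ∧
      Δ / Real.sqrt (4 + σ ^ 2) ≤ ‖θstar i - θstar j‖ / Real.sqrt (4 + σ ^ 2) := by
  intro i j hij
  have hS : 0 < √(4 + σ ^ 2) := by positivity
  refine ⟨?_, by gcongr; exact hsep i j hij⟩
  rw [div_le_iff₀' hS]
  refine (sq_le_sq₀ (norm_nonneg _) ?_).mp ?_
  · positivity
  rw [mul_pow, EuclideanSpace.norm_sq_eq (c i - c j), Finset.mul_sum,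
    ← b.sum_sq_norm_inner_right (θstar i - θstar j)]
  refine Finset.sum_le_sum fun k _ => ?_
  rw [← mul_pow, PiLp.sub_apply, hc, hc, hθ, Real.norm_eq_abs, Real.norm_eq_abs]
  gcongr
  exact abs_inner_sub_le_sqrt_mul_abs_sqrt_sub (b.norm_eq_one k) (hunit i) (hunit j) σ
end

section
/- Suppose N = K, σ ≤ Δ/4, and each model θ_k is Δ-proximal to cluster k, i.e. ‖θ_k − θ*_k‖ ≤ Δ/4 for every k ∈ [K]. Then for all i ≠ j, the SLV-means satisfy ‖c_i − c_j‖ ≥ √2 · (3 − √2) · Δ / 4, and in particular ‖c_i − c_j‖ > Δ/2. -/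
/-- Two distinct coordinates of absolute value at least `r` force norm at least `√2 * r`. -/
theorem EuclideanSpace.sqrt_two_mul_le_norm {ι : Type*} [Fintype ι] (v : EuclideanSpace ℝ ι)
    {i j : ι} (hij : i ≠ j) {r : ℝ} (hr : 0 ≤ r) (hi : r ≤ |v i|) (hj : r ≤ |v j|) :
    Real.sqrt 2 * r ≤ ‖v‖ := by
  classical
  have hpair : v i ^ 2 + v j ^ 2 ≤ ‖v‖ ^ 2 := by
    rw [EuclideanSpace.real_norm_sq_eq, ← Finset.sum_pair (f := fun k => v k ^ 2) hij]
    exact Finset.sum_le_sum_of_subset_of_nonneg (Finset.subset_univ _)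
      fun k _ _ => sq_nonneg (v k)
  have hi2 : r ^ 2 ≤ v i ^ 2 := by rw [← sq_abs (v i)]; gcongr
  have hj2 : r ^ 2 ≤ v j ^ 2 := by rw [← sq_abs (v j)]; gcongr
  refine (sq_le_sq₀ (by positivity) (norm_nonneg v)).mp ?_
  rw [mul_pow, Real.sq_sqrt zero_le_two]
  linarith

/-- If `x` lies within `Δ / 4` of `p` and `p`, `q` are `Δ`-separated, then the noisy distances
`√(‖x - ·‖² + σ²)` to `q` and `p` differ by at least `(3 - √2) * Δ / 4`. -/
theorem sqrt_norm_sub_sq_add_sq_gap {E : Type*} [SeminormedAddCommGroup E] {x p q : E} {Δ σ : ℝ}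
    (hΔ : 0 ≤ Δ) (hσ : 0 ≤ σ) (hσΔ : σ ≤ Δ / 4) (hx : ‖x - p‖ ≤ Δ / 4) (hpq : Δ ≤ ‖p - q‖) :
    (3 - Real.sqrt 2) * Δ / 4 ≤
      Real.sqrt (‖x - q‖ ^ 2 + σ ^ 2) - Real.sqrt (‖x - p‖ ^ 2 + σ ^ 2) := by
  have hfar : 3 * Δ / 4 ≤ ‖x - q‖ := by
    have h := norm_sub_le_norm_sub_add_norm_sub p x q
    rw [norm_sub_rev p x] at h
    linarith
  have hq : 3 * Δ / 4 ≤ Real.sqrt (‖x - q‖ ^ 2 + σ ^ 2) :=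
    hfar.trans (Real.le_sqrt_of_sq_le (le_add_of_nonneg_right (sq_nonneg σ)))
  have hp : Real.sqrt (‖x - p‖ ^ 2 + σ ^ 2) ≤ Real.sqrt 2 * (Δ / 4) := by
    refine Real.sqrt_le_iff.mpr ⟨by positivity, ?_⟩
    rw [mul_pow, Real.sq_sqrt zero_le_two, two_mul]
    gcongr
  linarith

/-- For a `Δ`-proximal collection of `K` models (`‖θ_k - θ*_k‖ ≤ Δ/4` for all `k`) and
noise level `σ ≤ Δ/4`, the SLV-means of distinct clusters satisfy
`‖c i - c j‖ ≥ √2 · (3 - √2) · Δ / 4 > Δ / 2`. -/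
theorem slv_mean_separation_proximal {d K : ℕ} (hK : 2 ≤ K)
    (θstar : Fin K → EuclideanSpace ℝ (Fin d))
    (hunit : ∀ k, ‖θstar k‖ = 1)
    (Δ : ℝ) (hΔ : 0 < Δ)
    (hsep : ∀ i j : Fin K, i ≠ j → Δ ≤ ‖θstar i - θstar j‖)
    (σ : ℝ) (hσ : 0 ≤ σ) (hσΔ : σ ≤ Δ / 4)
    (θ : Fin K → EuclideanSpace ℝ (Fin d))
    (hprox : ∀ k, ‖θ k - θstar k‖ ≤ Δ / 4)
    (c : Fin K → EuclideanSpace ℝ (Fin K))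
    (hc : ∀ k (j : Fin K), c k j = Real.sqrt (‖θ j - θstar k‖ ^ 2 + σ ^ 2)) :
    ∀ i j : Fin K, i ≠ j →
      Real.sqrt 2 * (3 - Real.sqrt 2) * Δ / 4 ≤ ‖c i - c j‖ ∧
      Δ / 2 < ‖c i - c j‖ := by
  intro i j hij
  have hsqrt_lt : Real.sqrt 2 < 3 := by
    rw [Real.sqrt_lt' (by norm_num)]; norm_num
  have hlt_sqrt : 4 / 3 < Real.sqrt 2 := Real.lt_sqrt_of_sq_lt (by norm_num)
  have hsq : Real.sqrt 2 * Real.sqrt 2 = 2 := Real.mul_self_sqrt zero_le_two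
  have hi : (3 - Real.sqrt 2) * Δ / 4 ≤ |(c i - c j) i| := by
    rw [PiLp.sub_apply, abs_sub_comm, hc, hc]
    exact (sqrt_norm_sub_sq_add_sq_gap hΔ.le hσ hσΔ (hprox i) (hsep i j hij)).trans
      (le_abs_self _)
  have hj : (3 - Real.sqrt 2) * Δ / 4 ≤ |(c i - c j) j| := by
    rw [PiLp.sub_apply, hc, hc]
    exact (sqrt_norm_sub_sq_add_sq_gap hΔ.le hσ hσΔ (hprox j) (hsep j i hij.symm)).trans
      (le_abs_self _)
  have hr : 0 ≤ (3 - Real.sqrt 2) * Δ / 4 :=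
    div_nonneg (mul_nonneg (sub_nonneg.mpr hsqrt_lt.le) hΔ.le) (by norm_num)
  have hmain : Real.sqrt 2 * (3 - Real.sqrt 2) * Δ / 4 ≤ ‖c i - c j‖ := by
    calc Real.sqrt 2 * (3 - Real.sqrt 2) * Δ / 4
        = Real.sqrt 2 * ((3 - Real.sqrt 2) * Δ / 4) := by ring
      _ ≤ ‖c i - c j‖ := EuclideanSpace.sqrt_two_mul_le_norm _ hij hr hi hj
  refine ⟨hmain, lt_of_lt_of_le ?_ hmain⟩
  have hconst : 2 < Real.sqrt 2 * (3 - Real.sqrt 2) := by linarith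
  linarith [mul_lt_mul_of_pos_right hconst hΔ]
end

section
/- Suppose c ≥ 4, 0 < Δ ≤ 2, η = (1/2)·(1 − Δ/(3c)), and ε ≥ 0 satisfies (2η/N)·‖N·I_d − HᵀH‖_op·‖θ − θ*‖ + (2η/N)·‖Hᵀξ‖ ≤ ε·Δ. Then the gradient-updated model satisfies ‖θ' − θ*‖ ≤ (Δ/(3c))·‖θ − θ*‖ + ε·Δ; in particular, if additionally ‖θ − θ*‖ ≤ 3, then ‖θ' − θ*‖ ≤ (1/c + ε)·Δ. -/
open Matrix

/-- Operator (spectral) norm of a real `d × d` matrix, i.e. the norm of the induced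
continuous linear map between Euclidean spaces. -/
noncomputable def matrixOpNorm {d : ℕ} (A : Matrix (Fin d) (Fin d) ℝ) : ℝ :=
  ‖LinearMap.toContinuousLinearMap (Matrix.toEuclideanLin A)‖

theorem norm_toEuclideanLin_le {d : ℕ} (A : Matrix (Fin d) (Fin d) ℝ)
    (v : EuclideanSpace ℝ (Fin d)) :
    ‖Matrix.toEuclideanLin A v‖ ≤ matrixOpNorm A * ‖v‖ :=
  (LinearMap.toContinuousLinearMap (Matrix.toEuclideanLin A)).le_opNorm v

/-- Suppose `c ≥ 4`, `0 < Δ ≤ 2`, `η = (1/2)(1 - Δ/(3c))`, and `ε ≥ 0` satisfies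
`(2η/N)‖N·I - HᵀH‖_op ‖θ - θ*‖ + (2η/N)‖Hᵀξ‖ ≤ εΔ`.  Then the gradient-updated model
`θ' = θ - η∇L̄(θ)` satisfies `‖θ' - θ*‖ ≤ (Δ/(3c))‖θ - θ*‖ + εΔ`; in particular, if
additionally `‖θ - θ*‖ ≤ 3`, then `‖θ' - θ*‖ ≤ (1/c + ε)Δ`. -/
theorem gradient_update_contraction
    {d N : ℕ} (hd : 1 ≤ d) (hN : 1 ≤ N)
    (θ θstar : EuclideanSpace ℝ (Fin d)) (H : Matrix (Fin N) (Fin d) ℝ)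
    (ξ : EuclideanSpace ℝ (Fin N)) (η : ℝ) (hη : 0 < η)
    (g : EuclideanSpace ℝ (Fin d))
    (hg : g = (2 / (N : ℝ)) •
      (Matrix.toEuclideanLin (Hᵀ * H) (θ - θstar) - Matrix.toEuclideanLin Hᵀ ξ))
    (θ' : EuclideanSpace ℝ (Fin d)) (hθ' : θ' = θ - η • g)
    (c Δ ε : ℝ) (hc : 4 ≤ c) (hΔ0 : 0 < Δ) (hΔ2 : Δ ≤ 2)
    (hηval : η = (1 / 2) * (1 - Δ / (3 * c)))
    (hε : 0 ≤ ε)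
    (herr : (2 * η / (N : ℝ)) *
        matrixOpNorm ((N : ℝ) • (1 : Matrix (Fin d) (Fin d) ℝ) - Hᵀ * H) * ‖θ - θstar‖
      + (2 * η / (N : ℝ)) * ‖Matrix.toEuclideanLin Hᵀ ξ‖ ≤ ε * Δ) :
    ‖θ' - θstar‖ ≤ (Δ / (3 * c)) * ‖θ - θstar‖ + ε * Δ ∧
    (‖θ - θstar‖ ≤ 3 → ‖θ' - θstar‖ ≤ (1 / c + ε) * Δ) := by
  have hN0 : (0 : ℝ) < N := by exact_mod_cast hN
  have hc0 : 0 < c := by linarith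
  have hcoef : 1 - 2 * η = Δ / (3 * c) := by rw [hηval]; ring
  have hk : 0 ≤ 2 * η / (N : ℝ) := by positivity
  set v := θ - θstar with hv
  set w := Matrix.toEuclideanLin Hᵀ ξ
  have hone : Matrix.toEuclideanLin (1 : Matrix (Fin d) (Fin d) ℝ) v = v := by
    simp [Matrix.toLpLin_one]
  have hlin : Matrix.toEuclideanLin ((N : ℝ) • (1 : Matrix (Fin d) (Fin d) ℝ) - Hᵀ * H) v
      = (N : ℝ) • v - Matrix.toEuclideanLin (Hᵀ * H) v := by
    rw [map_sub Matrix.toEuclideanLin, map_smul Matrix.toEuclideanLin,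
      LinearMap.sub_apply, LinearMap.smul_apply, hone]
  have hop := norm_toEuclideanLin_le ((N : ℝ) • (1 : Matrix (Fin d) (Fin d) ℝ) - Hᵀ * H) v
  set u := Matrix.toEuclideanLin ((N : ℝ) • (1 : Matrix (Fin d) (Fin d) ℝ) - Hᵀ * H) v
  have hdecomp : θ' - θstar
      = (Δ / (3 * c)) • v + (2 * η / (N : ℝ)) • u + (2 * η / (N : ℝ)) • w := by
    have hθ : θ' - θstar = v - η • g := by rw [hθ', hv]; abel
    rw [hθ, hg, hlin, ← hcoef]
    match_scalars <;> field_simp <;> ring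
  have hmain : ‖θ' - θstar‖ ≤ (Δ / (3 * c)) * ‖v‖ + ε * Δ := by
    have hmul := mul_le_mul_of_nonneg_left hop hk
    rw [← mul_assoc] at hmul
    have htri := norm_add₃_le (a := (Δ / (3 * c)) • v) (b := (2 * η / (N : ℝ)) • u)
      (c := (2 * η / (N : ℝ)) • w)
    rw [← hdecomp, norm_smul_of_nonneg (by positivity), norm_smul_of_nonneg hk,
      norm_smul_of_nonneg hk] at htri
    linarith
  refine ⟨hmain, fun h3 => hmain.trans ?_⟩
  have hscale : Δ / (3 * c) * ‖v‖ ≤ Δ / (3 * c) * 3 :=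
    mul_le_mul_of_nonneg_left h3 (by positivity)
  have hthree : Δ / (3 * c) * 3 = 1 / c * Δ := by field_simp
  linarith
end
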